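/- arXiv:1304.2488 — 2 statements merged into one kernel-verified Lean document; each statement's English description precedes it below -/
import Mathlib

section
/- For all real x ≥ 0, the second derivative of the function L(x) = log(Q(x)) satisfies L''(x) ≤ −2/π, where Q is the Gaussian Q-function. -/
open Real MeasureTheory

/-- The Gaussian Q-function: tail probability of a standard normal. -/
noncomputable def gaussQ (x : ℝ) : ℝ :=
  (1 / Real.sqrt (2 * Real.pi)) * ∫ u in Set.Ioi x, Real.exp (-u ^ 2 / 2)

/-- The standard normal density. -/
noncomputable def gaussPhi (x : ℝ) : ℝ :=
  Real.exp (-x ^ 2 / 2) / Real.sqrt (2 * Real.pi)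

/-- Unnormalised Gaussian tail. -/
noncomputable def gTail (x : ℝ) : ℝ := ∫ u in Set.Ioi x, Real.exp (-u ^ 2 / 2)

lemma gExp_integrable : Integrable (fun u : ℝ => Real.exp (-u ^ 2 / 2)) := by
  have h := integrable_exp_neg_mul_sq (b := 1 / 2) (by norm_num)
  refine h.congr (Filter.Eventually.of_forall fun u => ?_)
  simp only
  congr 1
  ring

lemma gTail_zero : gTail 0 = √(2 * π) / 2 := by
  have h := integral_gaussian_Ioi (1 / 2)
  have e : π / (1 / 2) = 2 * π := by ring
  rw [e] at h
  rw [← h, gTail]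
  congr 1
  funext u
  congr 1
  ring

lemma gTail_eq (x : ℝ) :
    gTail x = gTail 0 - ∫ u in (0 : ℝ)..x, Real.exp (-u ^ 2 / 2) := by
  have h := intervalIntegral.integral_Ioi_sub_Ioi' (a := 0) (b := x) (μ := volume)
    gExp_integrable.integrableOn gExp_integrable.integrableOn
  rw [← h]
  simp only [gTail]
  ring

lemma gTail_hasDerivAt (x : ℝ) : HasDerivAt gTail (-Real.exp (-x ^ 2 / 2)) x := by
  have hc : Continuous (fun u : ℝ => Real.exp (-u ^ 2 / 2)) := by fun_prop
  have h := (hc.integral_hasStrictDerivAt 0 x).hasDerivAt.const_sub (gTail 0)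
  have e : gTail = fun x => gTail 0 - ∫ u in (0 : ℝ)..x, Real.exp (-u ^ 2 / 2) :=
    funext gTail_eq
  rw [e]
  exact h

lemma gTail_tendsto : Filter.Tendsto gTail Filter.atTop (nhds 0) := by
  have h := intervalIntegral_tendsto_integral_Ioi (0 : ℝ) (μ := volume)
    gExp_integrable.integrableOn Filter.tendsto_id
  have h2 := h.const_sub (gTail 0)
  have e : gTail = fun x => gTail 0 - ∫ u in (0 : ℝ)..x, Real.exp (-u ^ 2 / 2) :=
    funext gTail_eq
  rw [e]
  have e0 : gTail 0 - ∫ u in Set.Ioi (0 : ℝ), Real.exp (-u ^ 2 / 2) = 0 := sub_self _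
  rw [e0] at h2
  exact h2

lemma gTail_pos (x : ℝ) : 0 < gTail x := by
  have hanti : StrictAnti gTail := by
    apply strictAnti_of_deriv_neg
    intro y
    rw [(gTail_hasDerivAt y).deriv]
    have := Real.exp_pos (-y ^ 2 / 2)
    linarith
  have h1 : gTail (x + 1) < gTail x := hanti (by linarith)
  have h2 : 0 ≤ gTail (x + 1) :=
    integral_nonneg fun u => (Real.exp_pos _).le
  linarith

/-- Auxiliary difference. -/
noncomputable def gD (c x : ℝ) : ℝ :=
  Real.exp (-x ^ 2 / 2) * (2 / (x + √(x ^ 2 + 4 * c))) - gTail x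

lemma gs_pos {c : ℝ} (hc : 0 < c) (x : ℝ) :
    0 < √(x ^ 2 + 4 * c) := Real.sqrt_pos.2 (by positivity)

lemma gD_hasDerivAt {c : ℝ} (hc : 0 < c) (x : ℝ) (hx : 0 ≤ x) :
    HasDerivAt (gD c) (Real.exp (-x ^ 2 / 2) *
      (2 * ((2 * c - 1) * √(x ^ 2 + 4 * c) - x) /
        (√(x ^ 2 + 4 * c) * (√(x ^ 2 + 4 * c) + x) ^ 2))) x := by
  have hs := gs_pos hc x
  have hss : √(x ^ 2 + 4 * c) ^ 2 = x ^ 2 + 4 * c := Real.sq_sqrt (by positivity)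
  have hne : x ^ 2 + 4 * c ≠ 0 := by positivity
  have hsum : x + √(x ^ 2 + 4 * c) ≠ 0 := by positivity
  have he : HasDerivAt (fun x : ℝ => Real.exp (-x ^ 2 / 2)) (Real.exp (-x ^ 2 / 2) * (-x)) x := by
    have := (((hasDerivAt_pow 2 x).fun_neg).div_const 2).exp
    refine this.congr_deriv ?_
    push_cast
    ring
  have h1 : HasDerivAt (fun x : ℝ => x ^ 2 + 4 * c) (2 * x) x := by
    have := (hasDerivAt_pow 2 x).add_const (4 * c)
    refine this.congr_deriv ?_
    push_cast
    ring
  have h2 := (hasDerivAt_id x).add (h1.sqrt hne)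
  have h3 := (hasDerivAt_const x (2 : ℝ)).div h2 hsum
  have h4 := (he.mul h3).sub (gTail_hasDerivAt x)
  refine h4.congr_deriv ?_
  simp only [id, Pi.add_apply, Pi.div_apply]
  generalize √(x ^ 2 + 4 * c) = s at *
  have hc' : c = (s ^ 2 - x ^ 2) / 4 := by linarith
  subst hc'
  have : s + x ≠ 0 := by positivity
  field_simp
  ring

lemma gD_tendsto {c : ℝ} (hc : 0 < c) : Filter.Tendsto (gD c) Filter.atTop (nhds 0) := by
  have h1 : Filter.Tendsto (fun x : ℝ => 2 / (x + √(x ^ 2 + 4 * c))) Filter.atTop (nhds 0) := by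
    apply Filter.Tendsto.const_div_atTop
    exact Filter.tendsto_atTop_mono (fun x => le_add_of_nonneg_right (Real.sqrt_nonneg _)) Filter.tendsto_id
  have h2 : Filter.Tendsto (fun x : ℝ => Real.exp (-x ^ 2 / 2) * (2 / (x + √(x ^ 2 + 4 * c))))
      Filter.atTop (nhds 0) := by
    refine squeeze_zero' ?_ ?_ h1
    · filter_upwards [Filter.eventually_ge_atTop 0] with x hx
      positivity
    · filter_upwards [Filter.eventually_ge_atTop 0] with x hx
      apply mul_le_of_le_one_left (by positivity)
      rw [Real.exp_le_one_iff]
      nlinarith [sq_nonneg x]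
  have h3 := h2.sub gTail_tendsto
  rw [sub_zero] at h3
  exact h3

lemma gP_mono {c m x y : ℝ} (hc : 0 < c) (hm : 0 < m) (hm1 : m < 1) (hx : 0 ≤ x) (hxy : x ≤ y)
    (h : y ≤ m * √(y ^ 2 + 4 * c)) : x ≤ m * √(x ^ 2 + 4 * c) := by
  have hsy : √(y ^ 2 + 4 * c) ^ 2 = y ^ 2 + 4 * c := Real.sq_sqrt (by positivity)
  have hsx : √(x ^ 2 + 4 * c) ^ 2 = x ^ 2 + 4 * c := Real.sq_sqrt (by positivity)
  have h1 : y ^ 2 ≤ (m * √(y ^ 2 + 4 * c)) ^ 2 := pow_le_pow_left₀ (by linarith) h 2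
  rw [mul_pow, hsy] at h1
  refine (pow_le_pow_iff_left₀ hx (by positivity) two_ne_zero).1 ?_
  rw [mul_pow, hsx]
  have h2 : x ^ 2 ≤ y ^ 2 := pow_le_pow_left₀ hx hxy 2
  have h3 : 0 ≤ 1 - m ^ 2 := by nlinarith
  nlinarith [mul_le_mul_of_nonneg_left h2 h3]

lemma gD_nonneg (x : ℝ) (hx : 0 ≤ x) : 0 ≤ gD (2 / π) x := by
  have hπ := Real.pi_pos
  have hc : 0 < 2 / π := by positivity
  have hm : 0 < 2 * (2 / π) - 1 := by
    have : 1 < 2 * (2 / π) := by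
      rw [← mul_div_assoc, lt_div_iff₀ hπ]
      linarith [Real.pi_lt_four]
    linarith
  have hm1 : 2 * (2 / π) - 1 < 1 := by
    have : 2 / π < 1 := by
      rw [div_lt_one hπ]
      linarith [Real.pi_gt_three]
    linarith
  have hcont : ContinuousOn (gD (2 / π)) (Set.Ici 0) := fun y hy =>
    (gD_hasDerivAt hc y hy).continuousAt.continuousWithinAt
  by_cases hP : x ≤ (2 * (2 / π) - 1) * √(x ^ 2 + 4 * (2 / π))
  · have hmono : MonotoneOn (gD (2 / π)) (Set.Icc 0 x) := by
      apply monotoneOn_of_deriv_nonneg (convex_Icc 0 x)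
      · exact hcont.mono fun y hy => hy.1
      · intro y hy
        rw [interior_Icc] at hy
        exact (gD_hasDerivAt hc y hy.1.le).differentiableAt.differentiableWithinAt
      · intro y hy
        rw [interior_Icc] at hy
        rw [(gD_hasDerivAt hc y hy.1.le).deriv]
        have h := gP_mono hc hm hm1 hy.1.le hy.2.le hP
        have hy0 := hy.1
        have h' := sub_nonneg.2 h
        positivity
    have h0 : gD (2 / π) 0 = 0 := by
      have e : √((0 : ℝ) ^ 2 + 4 * (2 / π)) = 4 / √(2 * π) := by
        rw [Real.sqrt_eq_iff_mul_self_eq (by positivity) (by positivity)]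
        rw [div_mul_div_comm, Real.mul_self_sqrt (by positivity)]
        field_simp
        norm_num
      rw [gD, gTail_zero, e]
      have : √(2 * π) ≠ 0 := by positivity
      simp
      field_simp
      norm_num
    rw [← h0]
    exact hmono ⟨le_rfl, hx⟩ ⟨hx, le_rfl⟩ hx
  · have hanti : AntitoneOn (gD (2 / π)) (Set.Ici x) := by
      apply antitoneOn_of_deriv_nonpos (convex_Ici x)
      · exact hcont.mono fun y hy => le_trans hx hy
      · intro y hy
        rw [interior_Ici] at hy
        exact (gD_hasDerivAt hc y (hx.trans (le_of_lt hy))).differentiableAt.differentiableWithinAt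
      · intro y hy
        rw [interior_Ici] at hy
        have hxy : x ≤ y := le_of_lt hy
        have hy0 : 0 ≤ y := hx.trans hxy
        rw [(gD_hasDerivAt hc y hy0).deriv]
        have h : ¬ y ≤ (2 * (2 / π) - 1) * √(y ^ 2 + 4 * (2 / π)) := fun h =>
          hP (gP_mono hc hm hm1 hx hxy h)
        apply mul_nonpos_of_nonneg_of_nonpos (by positivity)
        apply div_nonpos_of_nonpos_of_nonneg _ (by positivity)
        linarith
    refine le_of_tendsto (gD_tendsto hc) ?_
    filter_upwards [Filter.eventually_ge_atTop x] with y hy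
    exact hanti Set.self_mem_Ici hy hy

theorem second_deriv_log_gaussQ_le (x : ℝ) (hx : 0 ≤ x) :
    deriv (deriv (fun y : ℝ => Real.log (gaussQ y))) x ≤ -(2 / Real.pi) := by
  have hπ := Real.pi_pos
  have h1 : deriv (fun y : ℝ => Real.log (gaussQ y)) =
      fun y => -Real.exp (-y ^ 2 / 2) / gTail y := by
    funext y
    have hT := gTail_pos y
    have hk : 0 < 1 / √(2 * π) := by positivity
    have hd : HasDerivAt gaussQ (1 / √(2 * π) * -Real.exp (-y ^ 2 / 2)) y :=
      (gTail_hasDerivAt y).const_mul _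
    have hq : gaussQ y = 1 / √(2 * π) * gTail y := rfl
    have := (hd.log (by rw [hq]; positivity)).deriv
    rw [this, hq, mul_div_mul_left _ _ hk.ne']
  have hT := gTail_pos x
  have he : HasDerivAt (fun x : ℝ => -Real.exp (-x ^ 2 / 2)) (x * Real.exp (-x ^ 2 / 2)) x := by
    have := (((hasDerivAt_pow 2 x).fun_neg).div_const 2).exp.fun_neg
    refine this.congr_deriv ?_
    push_cast
    ring
  rw [h1, (he.fun_div (gTail_hasDerivAt x) hT.ne').deriv]
  have hD := gD_nonneg x hx
  have hc : 0 < 2 / π := by positivity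
  have hs := gs_pos hc x
  have hss : √(x ^ 2 + 4 * (2 / π)) ^ 2 = x ^ 2 + 4 * (2 / π) := Real.sq_sqrt (by positivity)
  rw [gD] at hD
  have hE := Real.exp_pos (-x ^ 2 / 2)
  generalize √(x ^ 2 + 4 * (2 / π)) = s at *
  generalize 2 / π = c at *
  generalize Real.exp (-x ^ 2 / 2) = E at *
  generalize gTail x = T at *
  rw [div_le_iff₀ (by positivity)]
  have hle : T ≤ E * (2 / (x + s)) := by linarith
  have hg : c * (2 / (x + s)) ^ 2 + x * (2 / (x + s)) = 1 := by
    have hc' : c = (s ^ 2 - x ^ 2) / 4 := by linarith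
    have : x + s ≠ 0 := by positivity
    rw [hc']
    field_simp
    ring
  generalize 2 / (x + s) = g at *
  have a1 : T ^ 2 ≤ (E * g) ^ 2 := pow_le_pow_left₀ hT.le hle 2
  have a2 := mul_le_mul_of_nonneg_left a1 hc.le
  have a3 := mul_le_mul_of_nonneg_left hle (mul_nonneg hx hE.le)
  have a4 : c * (E * g) ^ 2 + x * E * (E * g) = E ^ 2 := by
    linear_combination E ^ 2 * hg
  nlinarith
end

section
/- For all real x ≥ 0, the absolute error of the log-quadratic approximation satisfies |Q(x) − (1/2)·exp(−0.374·x² − 0.777·x)| < 10⁻³, where Q is the Gaussian Q-function. -/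
open Real MeasureTheory

namespace GQ

noncomputable def s : ℝ := Real.sqrt (2 * Real.pi)

lemma s_lo : (2.50662 : ℝ) < s := by
  unfold s
  apply Real.lt_sqrt_of_sq_lt
  have := Real.pi_gt_d6
  norm_num at *
  linarith

lemma s_hi : s < (2.50663 : ℝ) := by
  unfold s
  rw [Real.sqrt_lt' (by norm_num)]
  have := Real.pi_lt_d6
  norm_num at *
  linarith

lemma s_pos : 0 < s := by have := s_lo; linarith

noncomputable def I (x : ℝ) : ℝ := ∫ u in (0:ℝ)..x, Real.exp (-u ^ 2 / 2)

lemma cont_g : Continuous (fun u : ℝ => Real.exp (-u ^ 2 / 2)) := by fun_prop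

lemma I_deriv (x : ℝ) : HasDerivAt I (Real.exp (-x ^ 2 / 2)) x :=
  intervalIntegral.integral_hasDerivAt_right (cont_g.intervalIntegrable _ _)
    (cont_g.stronglyMeasurableAtFilter _ _) cont_g.continuousAt

lemma g_int : Integrable (fun u : ℝ => Real.exp (-u ^ 2 / 2)) := by
  have h := integrable_exp_neg_mul_sq (b := 1 / 2) (by norm_num)
  convert h using 2
  ring_nf

lemma g_Ioi : ∫ u in Set.Ioi (0:ℝ), Real.exp (-u ^ 2 / 2) = s / 2 := by
  have h := integral_gaussian_Ioi (1 / 2)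
  have e1 : (fun u : ℝ => Real.exp (-u ^ 2 / 2)) = fun u => Real.exp (-(1 / 2) * u ^ 2) := by
    funext u; ring_nf
  rw [e1, h, s]
  congr 2
  ring

noncomputable def f (x : ℝ) : ℝ := (1 / 2) * Real.exp (-(0.374) * x ^ 2 - 0.777 * x)

noncomputable def E (x : ℝ) : ℝ := 1 / 2 - (1 / s) * I x - f x

noncomputable def R (x : ℝ) : ℝ := (0.748 * x + 0.777) * s / 2 * Real.exp (0.126 * x ^ 2 - 0.777 * x)

lemma gaussQ_eq (x : ℝ) : gaussQ x = 1 / 2 - (1 / s) * I x := by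
  have h := intervalIntegral.integral_interval_add_Ioi (a := 0) (b := x) (μ := volume)
    (f := fun u : ℝ => Real.exp (-u ^ 2 / 2)) g_int.integrableOn g_int.integrableOn
  rw [g_Ioi] at h
  have h2 : ∫ u in Set.Ioi x, Real.exp (-u ^ 2 / 2) = s / 2 - I x := by
    unfold I; linarith
  unfold gaussQ
  rw [h2]
  have := s_pos
  change 1 / s * _ = _
  field_simp

lemma E_deriv (x : ℝ) : HasDerivAt E ((1 / s) * Real.exp (-x ^ 2 / 2) * (R x - 1)) x := by
  have hq : HasDerivAt (fun x : ℝ => -(0.374) * x ^ 2 - 0.777 * x) (-(0.748 * x + 0.777)) x := by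
    have := ((hasDerivAt_pow 2 x).const_mul (-(0.374))).sub ((hasDerivAt_id x).const_mul 0.777)
    refine this.congr_deriv ?_
    norm_num; ring
  have h := ((((I_deriv x).const_mul (1 / s)).const_sub (1 / 2)).sub (hq.exp.const_mul (1 / 2)))
  refine HasDerivAt.congr_deriv (f := E) h ?_
  have hs := s_pos
  have e1 : Real.exp (-(0.374) * x ^ 2 - 0.777 * x)
      = Real.exp (-x ^ 2 / 2) * Real.exp (0.126 * x ^ 2 - 0.777 * x) := by
    rw [← Real.exp_add]; congr 1; ring
  rw [e1, R]
  field_simp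
  ring

lemma phi_le (x : ℝ) : (1 / s) * Real.exp (-x ^ 2 / 2) ≤ 0.4 := by
  have h1 : Real.exp (-x ^ 2 / 2) ≤ 1 := by
    rw [Real.exp_le_one_iff]; nlinarith [sq_nonneg x]
  have hs := s_lo
  have hs' := s_pos
  rw [one_div, inv_mul_le_iff₀ hs']
  linarith

lemma E_cont : Continuous E := continuous_iff_continuousAt.2 fun x => (E_deriv x).continuousAt

lemma E_lower {x y d : ℝ} (hxy : x ≤ y) (hd : 0 ≤ d)
    (h : ∀ t, x ≤ t → t ≤ y → 1 - d ≤ R t) : E x - 0.4 * d * (y - x) ≤ E y := by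
  have := (convex_Icc x y).mul_sub_le_image_sub_of_le_deriv (f := E) (C := -(0.4 * d))
    E_cont.continuousOn (fun t _ => (E_deriv t).differentiableAt.differentiableWithinAt)
    (by
      intro t ht
      rw [interior_Icc] at ht
      rw [(E_deriv t).deriv]
      have h1 := h t ht.1.le ht.2.le
      have h2 := phi_le t
      have h3 : 0 ≤ (1 / s) * Real.exp (-t ^ 2 / 2) := by have := s_pos; positivity
      nlinarith)
    x ⟨le_refl _, hxy⟩ y ⟨hxy, le_refl _⟩ hxy
  linarith

lemma E_upper {x y d : ℝ} (hxy : x ≤ y) (hd : 0 ≤ d)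
    (h : ∀ t, x ≤ t → t ≤ y → R t ≤ 1 + d) : E y ≤ E x + 0.4 * d * (y - x) := by
  have := (convex_Icc x y).image_sub_le_mul_sub_of_deriv_le (f := E) (C := 0.4 * d)
    E_cont.continuousOn (fun t _ => (E_deriv t).differentiableAt.differentiableWithinAt)
    (by
      intro t ht
      rw [interior_Icc] at ht
      rw [(E_deriv t).deriv]
      have h1 := h t ht.1.le ht.2.le
      have h2 := phi_le t
      have h3 : 0 ≤ (1 / s) * Real.exp (-t ^ 2 / 2) := by have := s_pos; positivity
      nlinarith)
    x ⟨le_refl _, hxy⟩ y ⟨hxy, le_refl _⟩ hxy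
  linarith

lemma E_zero : E 0 = 0 := by simp [E, I, f]

lemma E_lim : Filter.Tendsto E Filter.atTop (nhds 0) := by
  have h1 : Filter.Tendsto I Filter.atTop (nhds (s / 2)) := by
    rw [← g_Ioi]
    exact intervalIntegral_tendsto_integral_Ioi 0 g_int.integrableOn Filter.tendsto_id
  have h2 : Filter.Tendsto f Filter.atTop (nhds ((1 / 2) * 0)) := by
    apply Filter.Tendsto.const_mul
    refine squeeze_zero' (Filter.Eventually.of_forall fun x => (Real.exp_pos _).le) ?_
      (Real.tendsto_exp_neg_atTop_nhds_zero.comp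
        (Filter.tendsto_id.const_mul_atTop (show (0:ℝ) < 0.777 by norm_num)))
    filter_upwards with x
    simp only [Function.comp, id]
    apply Real.exp_le_exp.2
    nlinarith [sq_nonneg x]
  have h := ((h1.const_mul (1 / s)).const_sub (1 / 2)).sub h2
  have hs := s_pos
  have e0 : 1 / 2 - 1 / s * (s / 2) - 1 / 2 * 0 = 0 := by field_simp; norm_num
  rw [e0] at h
  exact h

lemma R_deriv (x : ℝ) : HasDerivAt R
    (s / 2 * Real.exp (0.126 * x ^ 2 - 0.777 * x) *
      (0.188496 * x ^ 2 - 0.385392 * x + 0.144271)) x := by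
  have hq : HasDerivAt (fun x : ℝ => 0.126 * x ^ 2 - 0.777 * x) (0.252 * x - 0.777) x := by
    have := ((hasDerivAt_pow 2 x).const_mul 0.126).sub ((hasDerivAt_id x).const_mul 0.777)
    refine this.congr_deriv ?_
    norm_num; ring
  have hl : HasDerivAt (fun x : ℝ => (0.748 * x + 0.777) * s / 2) (0.748 * s / 2) x := by
    have := ((((hasDerivAt_id x).const_mul 0.748).add_const 0.777).mul_const s).div_const 2
    refine this.congr_deriv ?_
    norm_num
  have h := hl.mul hq.exp
  refine HasDerivAt.congr_deriv (f := R) h ?_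
  ring

lemma roots : ∃ m n : ℝ, 0.49 < m ∧ m < 0.5 ∧ 1.54 < n ∧ n < 1.56 ∧
    ∀ x : ℝ, 0.188496 * x ^ 2 - 0.385392 * x + 0.144271 = 0.188496 * ((x - m) * (x - n)) := by
  set D : ℝ := 0.385392 ^ 2 - 4 * 0.188496 * 0.144271 with hD
  have h0 : √D ^ 2 = D := Real.sq_sqrt (by rw [hD]; norm_num)
  have h1 : 0.199 < √D := by apply Real.lt_sqrt_of_sq_lt; rw [hD]; norm_num
  have h2 : √D < 0.2 := by rw [Real.sqrt_lt' (by norm_num), hD]; norm_num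
  refine ⟨(0.385392 - √D) / (2 * 0.188496), (0.385392 + √D) / (2 * 0.188496), ?_, ?_, ?_, ?_, ?_⟩
  · norm_num at *; linarith
  · norm_num at *; linarith
  · norm_num at *; linarith
  · norm_num at *; linarith
  · intro x
    rw [hD] at h0
    norm_num at *
    linarith

lemma R_diff : Differentiable ℝ R := fun x => (R_deriv x).differentiableAt

lemma shape : ∃ m n : ℝ, 0.49 < m ∧ m < 0.5 ∧ 1.54 < n ∧ n < 1.56 ∧
    MonotoneOn R (Set.Iic m) ∧ AntitoneOn R (Set.Icc m n) ∧ MonotoneOn R (Set.Ici n) := by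
  obtain ⟨m, n, h1, h2, h3, h4, h5⟩ := roots
  have hp : ∀ x, 0 < s / 2 * Real.exp (0.126 * x ^ 2 - 0.777 * x) := fun x => by
    have := s_pos; positivity
  refine ⟨m, n, h1, h2, h3, h4, ?_, ?_, ?_⟩
  · apply monotoneOn_of_deriv_nonneg (convex_Iic m) R_diff.continuous.continuousOn
      R_diff.differentiableOn
    intro x hx
    rw [interior_Iic] at hx
    rw [(R_deriv x).deriv, h5]
    refine mul_nonneg (hp x).le (mul_nonneg (by norm_num) ?_)
    have : x < m := hx
    exact mul_nonneg_of_nonpos_of_nonpos (by linarith) (by linarith)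
  · apply antitoneOn_of_deriv_nonpos (convex_Icc m n) R_diff.continuous.continuousOn
      R_diff.differentiableOn
    intro x hx
    rw [interior_Icc] at hx
    rw [(R_deriv x).deriv, h5]
    refine mul_nonpos_of_nonneg_of_nonpos (hp x).le (mul_nonpos_of_nonneg_of_nonpos (by norm_num) ?_)
    exact mul_nonpos_of_nonneg_of_nonpos (by linarith [hx.1]) (by linarith [hx.2])
  · apply monotoneOn_of_deriv_nonneg (convex_Ici n) R_diff.continuous.continuousOn
      R_diff.differentiableOn
    intro x hx
    rw [interior_Ici] at hx
    rw [(R_deriv x).deriv, h5]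
    refine mul_nonneg (hp x).le (mul_nonneg (by norm_num) ?_)
    have : n < x := hx
    exact mul_nonneg (by linarith) (by linarith)

lemma expb {y t lo hi : ℝ} (hy : y = 4 * t) (ht : |t| ≤ 1)
    (h0 : 0 ≤ (∑ m ∈ Finset.range 11, t ^ m / (m.factorial : ℝ)) - 1 / 30000000)
    (hl : lo ≤ ((∑ m ∈ Finset.range 11, t ^ m / (m.factorial : ℝ)) - 1 / 30000000) ^ 4)
    (hh : ((∑ m ∈ Finset.range 11, t ^ m / (m.factorial : ℝ)) + 1 / 30000000) ^ 4 ≤ hi) :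
    lo ≤ Real.exp y ∧ Real.exp y ≤ hi := by
  have h := Real.exp_bound ht (n := 11) (by norm_num)
  have h3 : |t| ^ 11 * (((11 : ℕ).succ : ℝ) / (((11 : ℕ).factorial : ℝ) * (11 : ℕ))) ≤ 1 / 30000000 := by
    have : |t| ^ 11 ≤ 1 := pow_le_one₀ (abs_nonneg _) ht
    have h4 : (((11 : ℕ).succ : ℝ) / (((11 : ℕ).factorial : ℝ) * (11 : ℕ))) ≤ 1 / 30000000 := by
      norm_num [Nat.factorial]
    calc _ ≤ 1 * (((11 : ℕ).succ : ℝ) / (((11 : ℕ).factorial : ℝ) * (11 : ℕ))) := by gcongr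
      _ ≤ _ := by linarith
  have h' := abs_le.1 (h.trans h3)
  have e : Real.exp y = Real.exp t ^ 4 := by
    rw [hy, ← Real.exp_nat_mul]; norm_num
  rw [e]
  constructor
  · refine hl.trans (pow_le_pow_left₀ h0 (by linarith [h'.1]) 4)
  · refine le_trans (pow_le_pow_left₀ (Real.exp_pos _).le (by linarith [h'.2]) 4) hh

noncomputable def d : ℕ → ℝ
  | 0 => 1
  | n + 1 => d n * (2 * n + 1)

noncomputable def S : ℕ → ℝ → ℝ
  | 0, _ => 0
  | n + 1, x => S n x + x ^ (2 * n + 1) / d (n + 1)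

lemma d_pos (n : ℕ) : 0 < d n := by
  induction n with
  | zero => simp [d]
  | succ k ih => simp only [d]; positivity

lemma S_zero (n : ℕ) : S n 0 = 0 := by
  induction n with
  | zero => simp [S]
  | succ k ih => simp [S, ih]

lemma hg (x : ℝ) : HasDerivAt (fun x : ℝ => Real.exp (-x ^ 2 / 2)) (Real.exp (-x ^ 2 / 2) * (-x)) x := by
  have := (((hasDerivAt_pow 2 x).neg).div_const 2).exp
  refine HasDerivAt.congr_deriv (f := fun x : ℝ => Real.exp (-x ^ 2 / 2)) this ?_
  simp
  ring

lemma S_deriv (n : ℕ) (x : ℝ) : HasDerivAt (fun x => Real.exp (-x ^ 2 / 2) * S n x)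
    (Real.exp (-x ^ 2 / 2) * (1 - x ^ (2 * n) / d n)) x := by
  induction n with
  | zero => simpa [S, d] using hasDerivAt_const x (0:ℝ)
  | succ k ih =>
    have h2 := (hg x).mul ((hasDerivAt_pow (2 * k + 1) x).div_const (d (k + 1)))
    have h := ih.add h2
    have e : (fun x => Real.exp (-x ^ 2 / 2) * S (k + 1) x) =
        (fun x => Real.exp (-x ^ 2 / 2) * S k x) +
          (fun x => Real.exp (-x ^ 2 / 2)) * fun x => x ^ (2 * k + 1) / d (k + 1) := by
      funext y
      simp only [S, Pi.add_apply, Pi.mul_apply]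
      ring
    rw [e]
    refine h.congr_deriv ?_
    · have := d_pos k
      simp only [d, Nat.add_sub_cancel]
      push_cast
      field_simp
      ring

lemma I_lo (n : ℕ) {x : ℝ} (hx : 0 ≤ x) : Real.exp (-x ^ 2 / 2) * S n x ≤ I x := by
  have hd : ∀ y, HasDerivAt (fun y => I y - Real.exp (-y ^ 2 / 2) * S n y)
    (Real.exp (-y ^ 2 / 2) - Real.exp (-y ^ 2 / 2) * (1 - y ^ (2 * n) / d n)) y :=
    fun y => (I_deriv y).sub (S_deriv n y)
  have hm : Monotone (fun y => I y - Real.exp (-y ^ 2 / 2) * S n y) := by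
    apply monotone_of_deriv_nonneg (fun y => (hd y).differentiableAt)
    intro y
    rw [(hd y).deriv]
    have h1 : 0 ≤ y ^ (2 * n) / d n := div_nonneg (Even.pow_nonneg (even_two_mul n) y) (d_pos n).le
    have h2 := Real.exp_pos (-y ^ 2 / 2)
    nlinarith
  have := hm hx
  simp only [S_zero, I, intervalIntegral.integral_same] at this
  unfold I
  linarith

lemma I_hi (n : ℕ) {x : ℝ} (hx : 0 ≤ x) :
    I x ≤ Real.exp (-x ^ 2 / 2) * S n x + x ^ (2 * n + 1) / d (n + 1) := by
  have hd : ∀ y, HasDerivAt (fun y => Real.exp (-y ^ 2 / 2) * S n y + y ^ (2 * n + 1) / d (n + 1) - I y)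
    (Real.exp (-y ^ 2 / 2) * (1 - y ^ (2 * n) / d n) + ((2 * n + 1 : ℕ) * y ^ (2 * n)) / d (n + 1)
      - Real.exp (-y ^ 2 / 2)) y :=
    fun y => ((S_deriv n y).add ((hasDerivAt_pow (2 * n + 1) y).div_const _)).sub (I_deriv y)
  have hm : Monotone (fun y => Real.exp (-y ^ 2 / 2) * S n y + y ^ (2 * n + 1) / d (n + 1) - I y) := by
    apply monotone_of_deriv_nonneg (fun y => (hd y).differentiableAt)
    intro y
    rw [(hd y).deriv]
    have h1 : 0 ≤ y ^ (2 * n) / d n := div_nonneg (Even.pow_nonneg (even_two_mul n) y) (d_pos n).le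
    have h3 : ((2 * n + 1 : ℕ) * y ^ (2 * n)) / d (n + 1) = y ^ (2 * n) / d n := by
      have := d_pos n
      simp only [d]; push_cast; field_simp
    have h2 : Real.exp (-y ^ 2 / 2) ≤ 1 := by
      rw [Real.exp_le_one_iff]; nlinarith [sq_nonneg y]
    rw [h3]
    nlinarith
  have := hm hx
  simp only [S_zero, I, intervalIntegral.integral_same] at this
  unfold I
  have h0 : (0:ℝ) ^ (2 * n + 1) = 0 := by simp
  rw [h0, zero_div, mul_zero] at this
  linarith

lemma R_02 : 1 - 0.001 ≤ R 0.2 ∧ R 0.2 ≤ 1 := by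
  obtain ⟨h1, h2⟩ : (0.860397:ℝ) ≤ Real.exp (0.126 * 0.2 ^ 2 - 0.777 * 0.2) ∧
      Real.exp (0.126 * 0.2 ^ 2 - 0.777 * 0.2) ≤ (0.8604:ℝ) := by
    apply expb (t := (0.126 * 0.2 ^ 2 - 0.777 * 0.2) / 4) <;>
      norm_num [Finset.sum_range_succ, Nat.factorial, abs_le]
  have := s_lo; have := s_hi
  unfold R
  norm_num at *
  constructor <;> nlinarith

lemma R_025 : 1 ≤ R 0.25 := by
  obtain ⟨h1, h2⟩ : (0.82996:ℝ) ≤ Real.exp (0.126 * 0.25 ^ 2 - 0.777 * 0.25) ∧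
      Real.exp (0.126 * 0.25 ^ 2 - 0.777 * 0.25) ≤ (0.83:ℝ) := by
    apply expb (t := (0.126 * 0.25 ^ 2 - 0.777 * 0.25) / 4) <;>
      norm_num [Finset.sum_range_succ, Nat.factorial, abs_le]
  have := s_lo; have := s_hi
  unfold R
  norm_num at *
  nlinarith

lemma R_09 : 1 ≤ R 0.9 ∧ R 0.9 ≤ 1 + 0.0005 := by
  obtain ⟨h1, h2⟩ : (0.550327:ℝ) ≤ Real.exp (0.126 * 0.9 ^ 2 - 0.777 * 0.9) ∧
      Real.exp (0.126 * 0.9 ^ 2 - 0.777 * 0.9) ≤ (0.55033:ℝ) := by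
    apply expb (t := (0.126 * 0.9 ^ 2 - 0.777 * 0.9) / 4) <;>
      norm_num [Finset.sum_range_succ, Nat.factorial, abs_le]
  have := s_lo; have := s_hi
  unfold R
  norm_num at *
  constructor <;> nlinarith

lemma R_205 : 1 - 0.0005 ≤ R 2.05 ∧ R 2.05 ≤ 1 := by
  obtain ⟨h1, h2⟩ : (0.345301:ℝ) ≤ Real.exp (0.126 * 2.05 ^ 2 - 0.777 * 2.05) ∧
      Real.exp (0.126 * 2.05 ^ 2 - 0.777 * 2.05) ≤ (0.345304:ℝ) := by
    apply expb (t := (0.126 * 2.05 ^ 2 - 0.777 * 2.05) / 4) <;>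
      norm_num [Finset.sum_range_succ, Nat.factorial, abs_le]
  have := s_lo; have := s_hi
  unfold R
  norm_num at *
  constructor <;> nlinarith

lemma R_21 : 1 ≤ R 2.1 := by
  obtain ⟨h1, h2⟩ : (0.34094:ℝ) ≤ Real.exp (0.126 * 2.1 ^ 2 - 0.777 * 2.1) ∧
      Real.exp (0.126 * 2.1 ^ 2 - 0.777 * 2.1) ≤ (0.341:ℝ) := by
    apply expb (t := (0.126 * 2.1 ^ 2 - 0.777 * 2.1) / 4) <;>
      norm_num [Finset.sum_range_succ, Nat.factorial, abs_le]
  have := s_lo; have := s_hi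
  unfold R
  norm_num at *
  nlinarith

lemma inv_s : 0.39894 ≤ 1 / s ∧ 1 / s ≤ 0.398945 := by
  have := s_lo; have := s_hi; have := s_pos
  constructor
  · rw [le_div_iff₀ s_pos]; norm_num at *; linarith
  · rw [div_le_iff₀ s_pos]; norm_num at *; linarith

lemma E_02 : -0.00095 ≤ E 0.2 := by
  obtain ⟨h1, h2⟩ : (0.84336:ℝ) ≤ Real.exp (-(0.374) * 0.2 ^ 2 - 0.777 * 0.2) ∧
      Real.exp (-(0.374) * 0.2 ^ 2 - 0.777 * 0.2) ≤ (0.843362:ℝ) := by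
    apply expb (t := (-(0.374) * 0.2 ^ 2 - 0.777 * 0.2) / 4) <;>
      norm_num [Finset.sum_range_succ, Nat.factorial, abs_le]
  obtain ⟨h3, h4⟩ : (0.980198:ℝ) ≤ Real.exp (-0.2 ^ 2 / 2) ∧
      Real.exp (-0.2 ^ 2 / 2) ≤ (0.9801995:ℝ) := by
    apply expb (t := (-0.2 ^ 2 / 2) / 4) <;>
      norm_num [Finset.sum_range_succ, Nat.factorial, abs_le]
  have h5 := I_hi 4 (x := 0.2) (by norm_num)
  have h6 : I 0.2 ≤ 0.19868 := by
    refine h5.trans ?_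
    simp only [S, d]
    norm_num at *
    linarith
  obtain ⟨h7, h8⟩ := inv_s
  have h9 : 1 / s * I 0.2 ≤ 0.398945 * 0.19868 := by
    have := s_pos
    calc _ ≤ 1 / s * 0.19868 := by gcongr
      _ ≤ _ := by gcongr
  unfold E f
  linarith

lemma E_205 : -0.00096 ≤ E 2.05 := by
  obtain ⟨h1, h2⟩ : (0.0422:ℝ) ≤ Real.exp (-(0.374) * 2.05 ^ 2 - 0.777 * 2.05) ∧
      Real.exp (-(0.374) * 2.05 ^ 2 - 0.777 * 2.05) ≤ (0.042233:ℝ) := by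
    apply expb (t := (-(0.374) * 2.05 ^ 2 - 0.777 * 2.05) / 4) <;>
      norm_num [Finset.sum_range_succ, Nat.factorial, abs_le]
  obtain ⟨h3, h4⟩ : (0.122:ℝ) ≤ Real.exp (-2.05 ^ 2 / 2) ∧
      Real.exp (-2.05 ^ 2 / 2) ≤ (0.122304:ℝ) := by
    apply expb (t := (-2.05 ^ 2 / 2) / 4) <;>
      norm_num [Finset.sum_range_succ, Nat.factorial, abs_le]
  have h5 := I_hi 13 (x := 2.05) (by norm_num)
  have h6 : I 2.05 ≤ 1.20274 := by
    refine h5.trans ?_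
    simp only [S, d]
    norm_num at *
    linarith
  obtain ⟨h7, h8⟩ := inv_s
  have h9 : 1 / s * I 2.05 ≤ 0.398945 * 1.20274 := by
    have := s_pos
    calc _ ≤ 1 / s * 1.20274 := by gcongr
      _ ≤ _ := by gcongr
  unfold E f
  linarith

lemma E_09 : E 0.9 ≤ 0.0006 := by
  obtain ⟨h1, h2⟩ : (0.36705:ℝ) ≤ Real.exp (-(0.374) * 0.9 ^ 2 - 0.777 * 0.9) ∧
      Real.exp (-(0.374) * 0.9 ^ 2 - 0.777 * 0.9) ≤ (0.3671:ℝ) := by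
    apply expb (t := (-(0.374) * 0.9 ^ 2 - 0.777 * 0.9) / 4) <;>
      norm_num [Finset.sum_range_succ, Nat.factorial, abs_le]
  obtain ⟨h3, h4⟩ : (0.666976:ℝ) ≤ Real.exp (-0.9 ^ 2 / 2) ∧
      Real.exp (-0.9 ^ 2 / 2) ≤ (0.66698:ℝ) := by
    apply expb (t := (-0.9 ^ 2 / 2) / 4) <;>
      norm_num [Finset.sum_range_succ, Nat.factorial, abs_le]
  have h5 := I_lo 8 (x := 0.9) (by norm_num)
  have h6 : 0.7919 ≤ I 0.9 := by
    refine le_trans ?_ h5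
    simp only [S, d]
    norm_num at *
    linarith
  obtain ⟨h7, h8⟩ := inv_s
  have h9 : 0.39894 * 0.7919 ≤ 1 / s * I 0.9 := by
    have := s_pos
    calc _ ≤ 1 / s * 0.7919 := by gcongr
      _ ≤ _ := by gcongr
  unfold E f
  linarith

lemma E_nonpos {x : ℝ} (h : ∀ t, x ≤ t → 1 ≤ R t) : E x ≤ 0 := by
  refine ge_of_tendsto E_lim ?_
  filter_upwards [Filter.eventually_ge_atTop x] with y hy
  have := E_lower (x := x) (y := y) (d := 0) hy le_rfl (fun t h1 _ => by linarith [h t h1])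
  linarith

lemma E_bounds {x : ℝ} (hx : 0 ≤ x) : -0.001 < E x ∧ E x < 0.001 := by
  obtain ⟨m, n, hm1, hm2, hn1, hn2, r1, r2, r3⟩ := shape
  obtain ⟨p1, p2⟩ := R_02
  have p3 := R_025
  obtain ⟨p4, p5⟩ := R_09
  obtain ⟨p6, p7⟩ := R_205
  have p8 := R_21
  have q1 := E_02
  have q2 := E_205
  have q3 := E_09
  have q0 := E_zero
  norm_num at hm1 hm2 hn1 hn2 p1 p2 p3 p4 p5 p6 p7 p8 q1 q2 q3 ⊢
  have M1 : ∀ a b, a ≤ b → b ≤ m → R a ≤ R b := fun a b h h' => r1 (h.trans h') h' h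
  have M2 : ∀ a b, m ≤ a → a ≤ b → b ≤ n → R b ≤ R a :=
    fun a b h h' h'' => r2 ⟨h, h'.trans h''⟩ ⟨h.trans h', h''⟩ h'
  have M3 : ∀ a b, n ≤ a → a ≤ b → R a ≤ R b := fun a b h h' => r3 h (h.trans h') h'
  have A1 : ∀ y, 1 / 4 ≤ y → y ≤ n → (m ≤ y → 1 ≤ R y) → ∀ t, 1 / 4 ≤ t → t ≤ y → 1 ≤ R t := by
    intro y hy hy2 hR t ht hty
    rcases le_total t m with h | h
    · linarith [M1 (1 / 4) t ht h]
    · linarith [M2 t y h hty hy2, hR (h.trans hty)]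
  have A2 : ∀ y δ, m ≤ y → 0 ≤ δ → R y ≤ 1 + δ → ∀ t, y ≤ t → t ≤ 41 / 20 → R t ≤ 1 + δ := by
    intro y δ hy hd hR t ht ht2
    rcases le_total t n with h | h
    · linarith [M2 y t hy ht h]
    · linarith [M3 t (41 / 20) h ht2]
  have B1 : ∀ y, 1 / 5 ≤ y → y ≤ 1 / 4 → -(98 / 100000) ≤ E y := by
    intro y h1 h2
    have := E_lower (d := 0.001) h1 (by norm_num)
      (fun t ht ht2 => by norm_num; linarith [M1 (1 / 5) t ht (by linarith)])
    norm_num at this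
    linarith
  have B2 : ∀ y, 41 / 20 ≤ y → y ≤ 21 / 10 → -(98 / 100000) ≤ E y := by
    intro y h1 h2
    have := E_lower (d := 0.0005) h1 (by norm_num)
      (fun t ht ht2 => by norm_num; linarith [M3 (41 / 20) t (by linarith) ht])
    norm_num at this
    linarith
  have b1 := B1 (1 / 4) (by norm_num) le_rfl
  have b2 := B2 (21 / 10) (by norm_num) le_rfl
  constructor
  · rcases le_total x (1 / 5) with h | h
    · have := E_upper (d := 0) h le_rfl (fun t ht ht2 => by linarith [M1 t (1 / 5) ht2 (by linarith)])
      linarith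
    rcases le_total x (1 / 4) with h' | h'
    · linarith [B1 x h h']
    rcases le_total (21 / 10) x with g | g
    · have := E_lower (d := 0) g le_rfl
        (fun t ht ht2 => by linarith [M3 (21 / 10) t (by linarith) ht])
      linarith
    rcases le_total (41 / 20) x with g' | g'
    · linarith [B2 x g' g]
    have K1 : x ≤ n → (m ≤ x → 1 ≤ R x) → -(1 / 1000) < E x := by
      intro k1 k2
      have := E_lower (d := 0) h' le_rfl (fun t ht ht2 => by linarith [A1 x h' k1 k2 t ht ht2])
      linarith
    have K2 : (∀ t, x ≤ t → t ≤ 41 / 20 → R t ≤ 1 + 0) → -(1 / 1000) < E x := by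
      intro k
      have := E_upper (d := 0) g' le_rfl k
      linarith
    rcases le_total x n with k | k
    · by_cases k2 : m ≤ x → 1 ≤ R x
      · exact K1 k k2
      · push Not at k2
        exact K2 (A2 x 0 k2.1 le_rfl (by linarith [k2.2]))
    · exact K2 (fun t ht ht2 => by linarith [M3 t (41 / 20) (k.trans ht) ht2])
  · rcases le_total x m with h | h
    · rcases le_total (R x) 1 with k | k
      · have := E_upper (d := 0) hx le_rfl (fun t ht ht2 => by linarith [M1 t x ht2 h])
        linarith
      · have := E_lower (d := 0) (show x ≤ 9 / 10 by linarith) le_rfl (fun t ht ht2 => by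
          rcases le_total t m with g | g
          · linarith [M1 x t ht g]
          · linarith [M2 t (9 / 10) g ht2 (by linarith)])
        linarith
    rcases le_total x (9 / 10) with h' | h'
    · have := E_lower (d := 0) h' le_rfl (fun t ht ht2 => by
          linarith [M2 t (9 / 10) (h.trans ht) ht2 (by linarith)])
      linarith
    have C := A2 (9 / 10) 0.0005 (by linarith) (by norm_num) (by norm_num; linarith)
    rcases le_total x (41 / 20) with g | g
    · have := E_upper (d := 0.0005) h' (by norm_num) (fun t ht ht2 => C t ht (ht2.trans g))
      norm_num at this
      linarith
    rcases le_total (R x) 1 with k | k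
    · have := E_upper (d := 0) g le_rfl
        (fun t ht ht2 => by linarith [M3 t x (by linarith) ht2])
      have := E_upper (d := 0.0005) (show (9 / 10 : ℝ) ≤ 41 / 20 by norm_num) (by norm_num) C
      norm_num at this
      linarith
    · have := E_nonpos (x := x) (fun t ht => by linarith [M3 x t (by linarith) ht])
      linarith

end GQ

theorem gaussQ_log_quadratic_approx (x : ℝ) (hx : 0 ≤ x) :
    |gaussQ x - (1 / 2) * Real.exp (-(0.374) * x ^ 2 - 0.777 * x)| < 1 / 1000 := by
  have h := GQ.E_bounds hx
  rw [GQ.gaussQ_eq]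
  unfold GQ.E GQ.f at h
  rw [abs_lt]
  constructor <;> norm_num at * <;> linarith
end
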